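/- arXiv:1903.01835 — 2 statements merged into one kernel-verified Lean document; each statement's English description precedes it below -/
import Mathlib

section
/- Let α ∈ ℝ \ {0}, β > 0, γ > 0, and N ∈ ℕ, and assume (2β/γ)·sinh(γ) < √((N+1)/(24|α|)). Then the functional differential equation y′(t) = α t^N (y(sin t))³ + β cosh(γ t) on [-1,1] with initial condition y(0) = 0 has a solution belonging to the Gevrey class G₁([-1,1]). -/
open Set

/-- `f` belongs to the Gevrey class `G_k([-1,1])`: it is `C^∞` on `[-1,1]` and there is
`B > 0` with `‖f^{(n)}‖_{∞,[-1,1]} ≤ B^{n+1} n^{n(1+1/k)}` for all `n` (with `0⁰ = 1`). -/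
def GevreyOn (k : ℝ) (f : ℝ → ℝ) : Prop :=
  ContDiffOn ℝ (⊤ : ℕ∞) f (Icc (-1:ℝ) 1) ∧
  ∃ B : ℝ, 0 < B ∧ ∀ n : ℕ, ∀ x ∈ Icc (-1:ℝ) 1,
    |iteratedDerivWithin n f (Icc (-1:ℝ) 1) x| ≤ B ^ (n+1) * (n:ℝ) ^ ((n:ℝ) * (1 + 1/k))

/-- The box `|Re z| ≤ 1 + a`, `|Im z| ≤ a`. -/
def Box (a : ℝ) : Set ℂ := {z | |z.re| ≤ 1 + a ∧ |z.im| ≤ a}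

lemma Box_mono {a b : ℝ} (h : a ≤ b) : Box a ⊆ Box b := fun z hz =>
  ⟨hz.1.trans (by linarith), hz.2.trans h⟩

lemma Box_smul {a : ℝ} {z : ℂ} (hz : z ∈ Box a) {s : ℝ} (h0 : 0 ≤ s) (h1 : s ≤ 1) :
    (s : ℂ) * z ∈ Box a := by
  obtain ⟨h2, h3⟩ := hz
  constructor
  · simp only [Complex.re_ofReal_mul, abs_mul, abs_of_nonneg h0]
    nlinarith [abs_nonneg z.re]
  · simp only [Complex.im_ofReal_mul, abs_mul, abs_of_nonneg h0]
    nlinarith [abs_nonneg z.im]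

lemma Box_norm {a : ℝ} {z : ℂ} (hz : z ∈ Box a) : ‖z‖ ≤ 1 + 2 * a := by
  have := Complex.norm_le_abs_re_add_abs_im z
  linarith [hz.1, hz.2]

lemma sinh_le_aux {y : ℝ} (h1 : y ≤ 1) (h0 : 0 ≤ y) : Real.sinh y ≤ y + y ^ 2 := by
  have h2 := Real.abs_exp_sub_one_sub_id_le (x := y) (by rw [abs_of_nonneg h0]; exact h1)
  have h3 := Real.abs_exp_sub_one_sub_id_le (x := -y) (by rw [abs_neg, abs_of_nonneg h0]; exact h1)
  rw [Real.sinh_eq]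
  have := (abs_le.1 h2).2
  have := (abs_le.1 h3).1
  nlinarith

lemma sin_Box {a b : ℝ} (ha : 0 ≤ a) (ha1 : a ≤ 1 / 10) (hab : a + a ^ 2 ≤ b) {z : ℂ}
    (hz : z ∈ Box a) : Complex.sin z ∈ Box b := by
  obtain ⟨hx, hy⟩ := hz
  have hb : 0 ≤ b := by nlinarith
  have hre : (Complex.sin z).re = Real.sin z.re * Real.cosh z.im := by
    rw [Complex.sin_eq, ← Complex.ofReal_sin, ← Complex.ofReal_cosh, ← Complex.ofReal_cos,
      ← Complex.ofReal_sinh]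
    simp [-Complex.ofReal_sin, -Complex.ofReal_cosh, -Complex.ofReal_cos, -Complex.ofReal_sinh]
  have him : (Complex.sin z).im = Real.cos z.re * Real.sinh z.im := by
    rw [Complex.sin_eq, ← Complex.ofReal_sin, ← Complex.ofReal_cosh, ← Complex.ofReal_cos,
      ← Complex.ofReal_sinh]
    simp [-Complex.ofReal_sin, -Complex.ofReal_cosh, -Complex.ofReal_cos, -Complex.ofReal_sinh]
  have hs : |Real.sinh z.im| ≤ a + a ^ 2 := by
    rw [Real.abs_sinh]
    exact (Real.sinh_le_sinh.2 hy).trans (sinh_le_aux (by linarith) ha)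
  constructor
  · have h1 : |Real.sin z.re * Real.cosh z.im| ≤ 1 := by
      rw [← sq_le_one_iff_abs_le_one, mul_pow, Real.cosh_sq, ← sq_abs (Real.sinh _)]
      have h2 := Real.one_sub_sq_div_two_le_cos (x := z.re)
      have h3 : z.re ^ 2 ≤ 1.21 := by
        rw [← sq_abs]; nlinarith [abs_nonneg z.re]
      have h4 := Real.sin_sq_add_cos_sq z.re
      have h5 : Real.sin z.re ^ 2 ≤ 0.85 := by nlinarith
      have h6 : |Real.sinh z.im| ≤ 0.11 := by nlinarith
      have h7 : |Real.sinh z.im| ^ 2 ≤ 0.0121 := by nlinarith [abs_nonneg (Real.sinh z.im)]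
      nlinarith [sq_nonneg (Real.sin z.re)]
    rw [hre]; linarith
  · rw [him, abs_mul]
    have := Real.abs_cos_le_one z.re
    nlinarith [abs_nonneg (Real.sinh z.im)]

/-- Estimate of a primitive along a ray. -/
lemma ray_bound {a C : ℝ} {N : ℕ} (f f' : ℂ → ℂ)
    (hf : ∀ z, HasDerivAt f (f' z) z) (h0 : f 0 = 0)
    (hb : ∀ z ∈ Box a, ‖f' z‖ ≤ C * ‖z‖ ^ N) {z : ℂ} (hz : z ∈ Box a) :
    ‖f z‖ ≤ C * ‖z‖ ^ (N + 1) / (N + 1) := by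
  have hg : ∀ s : ℝ, HasDerivAt (fun s : ℝ => f (s * z)) (f' (s * z) * z) s := by
    intro s
    have h1 : HasDerivAt (fun s : ℂ => f (s * z)) (f' (s * z) * z) (s : ℂ) := by
      have := (hf (s * z)).comp (s : ℂ) ((hasDerivAt_id (s : ℂ)).mul_const z)
      simpa using! this
    exact h1.comp_ofReal
  have key := image_norm_le_of_norm_deriv_right_le_deriv_boundary (a := 0) (b := 1)
    (f := fun s : ℝ => f (s * z)) (f' := fun s : ℝ => f' (s * z) * z)
    (B := fun s => C * ‖z‖ ^ (N + 1) / (N + 1) * s ^ (N + 1))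
    (B' := fun s => C * ‖z‖ ^ (N + 1) * s ^ N)
    (fun s _ => (hg s).continuousAt.continuousWithinAt)
    (fun s _ => (hg s).hasDerivWithinAt) (by simp [h0])
    (fun s => by
      have := (hasDerivAt_pow (N + 1) s).const_mul (C * ‖z‖ ^ (N + 1) / (N + 1))
      convert! this using 1
      have : (N : ℝ) + 1 ≠ 0 := by positivity
      push_cast
      field_simp)
    (fun s hs => by
      have := hb _ (Box_smul hz hs.1 hs.2.le)
      rw [norm_mul]
      calc _ ≤ C * ‖(s : ℂ) * z‖ ^ N * ‖z‖ := by gcongr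
        _ = _ := by
          rw [norm_mul, Complex.norm_real, Real.norm_of_nonneg hs.1]; ring)
    (x := 1) (by simp)
  simpa using key

lemma sinh_bound {a γ : ℝ} (hγ : 0 < γ) (ha : 0 ≤ a)
    (h : Real.sinh (γ * (1 + a)) + Real.cosh (γ * (1 + a)) * (γ * a) ≤ 2 * Real.sinh γ) {z : ℂ}
    (hz : z ∈ Box a) : ‖Complex.sinh (γ * z)‖ ≤ 2 * Real.sinh γ := by
  obtain ⟨hx, hy⟩ := hz
  have e : Complex.sinh (γ * z) = ((Real.sinh (γ * z.re) * Real.cos (γ * z.im) : ℝ) : ℂ)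
      + ((Real.cosh (γ * z.re) * Real.sin (γ * z.im) : ℝ) : ℂ) * Complex.I := by
    conv_lhs => rw [← Complex.re_add_im z]
    rw [mul_add, ← mul_assoc, Complex.sinh_add, Complex.cosh_mul_I, Complex.sinh_mul_I]
    push_cast
    ring
  have hx' : |γ * z.re| ≤ γ * (1 + a) := by rw [abs_mul, abs_of_pos hγ]; gcongr
  have hy' : |γ * z.im| ≤ γ * a := by rw [abs_mul, abs_of_pos hγ]; gcongr
  refine le_trans ?_ h
  rw [e]
  refine (norm_add_le _ _).trans (add_le_add ?_ ?_)
  · rw [Complex.norm_real, Real.norm_eq_abs, abs_mul, Real.abs_sinh]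
    have h1 := Real.sinh_le_sinh.2 hx'
    have h2 := Real.abs_cos_le_one (γ * z.im)
    have h3 : 0 ≤ Real.sinh |γ * z.re| := Real.sinh_nonneg_iff.2 (abs_nonneg _)
    nlinarith
  · rw [norm_mul, Complex.norm_real, Complex.norm_I, mul_one, Real.norm_eq_abs, abs_mul,
      abs_of_pos (Real.cosh_pos _)]
    have h1 : Real.cosh (γ * z.re) ≤ Real.cosh (γ * (1 + a)) := by
      rw [Real.cosh_le_cosh]; exact hx'.trans (le_abs_self _)
    have h2 : |Real.sin (γ * z.im)| ≤ γ * a := Real.abs_sin_le_abs.trans hy'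
    exact mul_le_mul h1 h2 (abs_nonneg _) (Real.cosh_pos _).le

lemma exists_prim (f : ℂ → ℂ) (hf : Differentiable ℂ f) :
    ∃ g : ℂ → ℂ, g 0 = 0 ∧ ∀ z, HasDerivAt g (f z) z := by
  obtain ⟨g, h1, h2⟩ := (hf.isExactOn_univ).with_val_at 0 0
  exact ⟨g, by simpa using h1, by simpa using h2⟩

/-- The right-hand side of the equation, complexified. -/
noncomputable def rhsC (α β γ : ℝ) (N : ℕ) (y : ℂ → ℂ) (z : ℂ) : ℂ :=
  α * z ^ N * (y (Complex.sin z)) ^ 3 + β * Complex.cosh (γ * z)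

lemma exists_picard (α β γ : ℝ) (N : ℕ) :
    ∃ y : ℕ → ℂ → ℂ, y 0 = 0 ∧ (∀ m, y m 0 = 0) ∧
      (∀ m, Differentiable ℂ (y m)) ∧
      (∀ m z, HasDerivAt (y (m + 1)) (rhsC α β γ N (y m) z) z) := by
  have step : ∀ y : {y : ℂ → ℂ // Differentiable ℂ y ∧ y 0 = 0},
      ∃ g : {y : ℂ → ℂ // Differentiable ℂ y ∧ y 0 = 0},
        ∀ z, HasDerivAt g.1 (rhsC α β γ N y.1 z) z := by
    rintro ⟨y, hy, -⟩
    have : Differentiable ℂ (rhsC α β γ N y) := by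
      unfold rhsC
      have := hy.comp Complex.differentiable_sin
      simp only [Function.comp_def] at this
      fun_prop
    obtain ⟨g, hg0, hg⟩ := exists_prim _ this
    exact ⟨⟨g, fun z => (hg z).differentiableAt, hg0⟩, hg⟩
  choose F hF using step
  let Y : ℕ → {y : ℂ → ℂ // Differentiable ℂ y ∧ y 0 = 0} := fun m =>
    F^[m] ⟨0, differentiable_const 0, rfl⟩
  refine ⟨fun m => (Y m).1, rfl, fun m => (Y m).2.2, fun m => (Y m).2.1, fun m z => ?_⟩
  have : Y (m + 1) = F (Y m) := Function.iterate_succ_apply' _ _ _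
  simp only [this]
  exact hF _ z

lemma cube_bound {p r : ℂ} {M δ : ℝ} (hp : ‖p‖ ≤ M) (hr : ‖r‖ ≤ M) (hd : ‖p - r‖ ≤ δ) :
    ‖p ^ 3 - r ^ 3‖ ≤ 3 * M ^ 2 * δ := by
  have hM : 0 ≤ M := (norm_nonneg _).trans hp
  have e : p ^ 3 - r ^ 3 = (p ^ 2 + p * r + r ^ 2) * (p - r) := by ring
  have h1 : ‖p ^ 2 + p * r + r ^ 2‖ ≤ 3 * M ^ 2 := by
    calc _ ≤ ‖p ^ 2‖ + ‖p * r‖ + ‖r ^ 2‖ := norm_add₃_le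
      _ = ‖p‖ ^ 2 + ‖p‖ * ‖r‖ + ‖r‖ ^ 2 := by simp
      _ ≤ M ^ 2 + M * M + M ^ 2 := by gcongr
      _ = _ := by ring
  rw [e, norm_mul]
  gcongr

/-- The radius at step `m`. -/
noncomputable def rad (a : ℝ) (m : ℕ) : ℝ := a / (m + 1)

lemma rad_pos {a : ℝ} (ha : 0 < a) (m : ℕ) : 0 < rad a m := by unfold rad; positivity

lemma rad_le {a : ℝ} (ha : 0 < a) (m : ℕ) : rad a m ≤ a := by
  unfold rad
  apply div_le_self ha.le
  have : (0 : ℝ) ≤ m := by positivity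
  linarith

lemma rad_anti {a : ℝ} (ha : 0 < a) (m : ℕ) : rad a (m + 1) ≤ rad a m := by
  unfold rad
  push_cast
  gcongr
  linarith

lemma rad_step {a : ℝ} (ha : 0 < a) (ha1 : a ≤ 1 / 10) (m : ℕ) :
    rad a (m + 1) + rad a (m + 1) ^ 2 ≤ rad a m := by
  unfold rad
  push_cast
  have hm : (0 : ℝ) ≤ m := by positivity
  have e : a / (m + 1) - (a / (m + 1 + 1) + (a / (m + 1 + 1)) ^ 2)
      = a * ((m + 2) - a * (m + 1)) / ((m + 1) * (m + 2) ^ 2) := by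
    field_simp
    ring
  have : 0 ≤ a * ((m + 2) - a * (m + 1)) / ((m + 1) * ((m : ℝ) + 2) ^ 2) := by
    apply div_nonneg _ (by positivity)
    apply mul_nonneg ha.le
    nlinarith
  linarith

section bounds
variable {α β γ : ℝ} {N : ℕ} {a σ : ℝ} {y : ℕ → ℂ → ℂ}

lemma picard_bound (hγ : 0 < γ) (hβ : 0 < β) (ha : 0 < a) (ha1 : a ≤ 1 / 10)
    (hσ : σ = 2 * β / γ * Real.sinh γ) (hσ1 : 24 * (|α| / (N + 1)) * σ ^ 2 ≤ 1)
    (hN : (1 + 2 * a) ^ (N + 1) ≤ 2)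
    (hs : Real.sinh (γ * (1 + a)) + Real.cosh (γ * (1 + a)) * (γ * a) ≤ 2 * Real.sinh γ)
    (h0 : y 0 = 0) (hy0 : ∀ m, y m 0 = 0)
    (hy : ∀ m z, HasDerivAt (y (m + 1)) (rhsC α β γ N (y m) z) z) (m : ℕ) :
    ∀ z ∈ Box (rad a m), ‖y m z‖ ≤ 3 / 2 * σ := by
  have hσ0 : 0 ≤ σ := by
    have := Real.sinh_nonneg_iff.2 hγ.le
    rw [hσ]; positivity
  induction m with
  | zero => intro z _; simp [h0]; exact hσ0
  | succ m ih =>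
    intro z hz
    have hza : z ∈ Box a := Box_mono (rad_le ha _) hz
    have hd : ∀ z, HasDerivAt (fun z => y (m + 1) z - β / γ * Complex.sinh (γ * z))
        (α * z ^ N * (y m (Complex.sin z)) ^ 3) z := by
      intro z
      have h1 : HasDerivAt (fun z : ℂ => Complex.sinh (γ * z)) (Complex.cosh (γ * z) * γ) z := by
        have := (Complex.hasDerivAt_sinh (γ * z)).comp z ((hasDerivAt_id z).const_mul (γ : ℂ))
        simpa using! this
      have h2 := (hy m z).sub (h1.const_mul ((β : ℂ) / γ))
      convert! h2 using 1
      have : (γ : ℂ) ≠ 0 := by exact_mod_cast hγ.ne'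
      unfold rhsC
      field_simp
      ring
    have hb := ray_bound (a := rad a (m + 1)) (C := |α| * (3 / 2 * σ) ^ 3) (N := N) _ _ hd
      (by simp [hy0]) (fun w hw => by
        have := ih _ (sin_Box (rad_pos ha _).le ((rad_le ha _).trans ha1) (rad_step ha ha1 m) hw)
        rw [norm_mul, norm_mul, Complex.norm_real, norm_pow, norm_pow, Real.norm_eq_abs]
        calc _ ≤ |α| * ‖w‖ ^ N * (3 / 2 * σ) ^ 3 := by gcongr
          _ = _ := by ring) hz
    have hzN : ‖z‖ ^ (N + 1) ≤ 2 :=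
      (pow_le_pow_left₀ (norm_nonneg _) (Box_norm hza) _).trans hN
    have h2 : |α| * (3 / 2 * σ) ^ 3 * ‖z‖ ^ (N + 1) / (N + 1) ≤ 1 / 2 * σ := by
      calc _ ≤ |α| * (3 / 2 * σ) ^ 3 * 2 / (N + 1) := by gcongr
        _ = (24 * (|α| / (N + 1)) * σ ^ 2) * (σ * (27 / 96)) := by ring
        _ ≤ 1 * (σ * (27 / 96)) := by gcongr
        _ ≤ _ := by linarith
    have h3 : ‖(β : ℂ) / γ * Complex.sinh (γ * z)‖ ≤ σ := by
      rw [norm_mul, norm_div, Complex.norm_real, Complex.norm_real, Real.norm_of_nonneg hβ.le,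
        Real.norm_of_nonneg hγ.le]
      calc _ ≤ β / γ * (2 * Real.sinh γ) := by gcongr; exact sinh_bound hγ ha.le hs hza
        _ = σ := by rw [hσ]; ring
    calc ‖y (m + 1) z‖ = ‖(y (m + 1) z - β / γ * Complex.sinh (γ * z))
          + β / γ * Complex.sinh (γ * z)‖ := by congr 1; ring
      _ ≤ _ := norm_add_le _ _
      _ ≤ 1 / 2 * σ + σ := add_le_add (hb.trans h2) h3
      _ = _ := by ring

lemma picard_diff (hσ0 : 0 ≤ σ) (ha : 0 < a) (ha1 : a ≤ 1 / 10)
    (hσ1 : 24 * (|α| / (N + 1)) * σ ^ 2 ≤ 1)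
    (hN : (1 + 2 * a) ^ (N + 1) ≤ 2)
    (hy0 : ∀ m, y m 0 = 0)
    (hy : ∀ m z, HasDerivAt (y (m + 1)) (rhsC α β γ N (y m) z) z)
    (hb : ∀ m, ∀ z ∈ Box (rad a m), ‖y m z‖ ≤ 3 / 2 * σ) (m : ℕ) :
    ∀ z ∈ Box (rad a (m + 1)), ‖y (m + 1) z - y m z‖ ≤ 3 * σ * (9 / 16) ^ m := by
  induction m with
  | zero =>
    intro z hz
    have h1 := hb 1 z hz
    have h2 := hb 0 z (Box_mono (rad_anti ha 0) hz)
    have := norm_sub_le (y (0 + 1) z) (y 0 z)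
    norm_num at *
    linarith
  | succ m ih =>
    intro z hz
    have hza : z ∈ Box a := Box_mono (rad_le ha _) hz
    have hd : ∀ z, HasDerivAt (fun z => y (m + 1 + 1) z - y (m + 1) z)
        (α * z ^ N * ((y (m + 1) (Complex.sin z)) ^ 3 - (y m (Complex.sin z)) ^ 3)) z := by
      intro z
      convert! (hy (m + 1) z).sub (hy m z) using 1
      unfold rhsC
      ring
    have hb := ray_bound (a := rad a (m + 1 + 1))
      (C := |α| * (3 * (3 / 2 * σ) ^ 2 * (3 * σ * (9 / 16) ^ m))) (N := N) _ _ hd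
      (by simp [hy0]) (fun w hw => by
        have hw' := sin_Box (rad_pos ha _).le ((rad_le ha _).trans ha1) (rad_step ha ha1 _) hw
        have := cube_bound (hb (m + 1) _ hw') (hb m _ (Box_mono (rad_anti ha m) hw')) (ih _ hw')
        rw [norm_mul, norm_mul, Complex.norm_real, norm_pow, Real.norm_eq_abs]
        calc _ ≤ |α| * ‖w‖ ^ N * (3 * (3 / 2 * σ) ^ 2 * (3 * σ * (9 / 16) ^ m)) := by gcongr
          _ = _ := by ring) hz
    have hzN : ‖z‖ ^ (N + 1) ≤ 2 :=
      (pow_le_pow_left₀ (norm_nonneg _) (Box_norm hza) _).trans hN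
    refine hb.trans ?_
    calc _ ≤ |α| * (3 * (3 / 2 * σ) ^ 2 * (3 * σ * (9 / 16) ^ m)) * 2 / (N + 1) := by gcongr
      _ = (24 * (|α| / (N + 1)) * σ ^ 2) * (3 * σ * (9 / 16) ^ (m + 1)) := by ring
      _ ≤ 1 * (3 * σ * (9 / 16) ^ (m + 1)) := by gcongr
      _ = _ := by ring

end bounds

section real

/-- The right-hand side of the equation on the real line. -/
noncomputable def rhsR (α β γ : ℝ) (N : ℕ) (u : ℝ → ℝ) (t : ℝ) : ℝ :=
  α * t ^ N * (u (Real.sin t)) ^ 3 + β * Real.cosh (γ * t)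

variable {α β γ : ℝ} {N : ℕ}

lemma picard_real {y : ℕ → ℂ → ℂ} (h0 : y 0 = 0) (hy0 : ∀ m, y m 0 = 0)
    (hy : ∀ m z, HasDerivAt (y (m + 1)) (rhsC α β γ N (y m) z) z) (m : ℕ) :
    ∀ t : ℝ, (y m t).im = 0 := by
  induction m with
  | zero => intro t; simp [h0]
  | succ m ih =>
    have hd : ∀ t : ℝ, HasDerivAt (fun t : ℝ => (y (m + 1) t).im) 0 t := by
      intro t
      have h1 := ((hy m t).const_mul (-Complex.I)).real_of_complex
      convert! h1 using 1
      · funext s; simp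
      · have h2 : y m (Complex.sin t) = ((y m (Real.sin t : ℝ)).re : ℂ) := by
          rw [Complex.ofReal_sin]
          apply Complex.ext
          · simp
          · rw [← Complex.ofReal_sin, ih]; simp
        have h3 : rhsC α β γ N (y m) t = ((rhsR α β γ N (fun s => (y m s).re) t : ℝ) : ℂ) := by
          unfold rhsC rhsR
          rw [h2]
          push_cast
          rfl
        rw [h3]; simp
    intro t
    have := is_const_of_deriv_eq_zero (fun t => (hd t).differentiableAt)
      (fun t => (hd t).deriv) t 0
    simpa [hy0] using this

lemma picard_real_deriv {y : ℕ → ℂ → ℂ} (him : ∀ m (t : ℝ), (y m t).im = 0)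
    (hy : ∀ m z, HasDerivAt (y (m + 1)) (rhsC α β γ N (y m) z) z) (m : ℕ) (t : ℝ) :
    HasDerivAt (fun t : ℝ => (y (m + 1) t).re) (rhsR α β γ N (fun s => (y m s).re) t) t := by
  have h1 := (hy m t).real_of_complex
  have h2 : y m (Complex.sin t) = ((y m (Real.sin t : ℝ)).re : ℂ) := by
    rw [Complex.ofReal_sin]
    apply Complex.ext
    · simp
    · rw [← Complex.ofReal_sin, him]; simp
  have h3 : rhsC α β γ N (y m) t = ((rhsR α β γ N (fun s => (y m s).re) t : ℝ) : ℂ) := by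
    unfold rhsC rhsR
    rw [h2]
    push_cast
    rfl
  rw [h3, Complex.ofReal_re] at h1
  exact h1

lemma sin_mem (t : ℝ) : Real.sin t ∈ Icc (-1 : ℝ) 1 := ⟨Real.neg_one_le_sin t, Real.sin_le_one t⟩

lemma limit_ode {w : ℕ → ℝ → ℝ} (h0 : w 0 = 0) (hw0 : ∀ m, w m 0 = 0)
    (hw : ∀ m t, HasDerivAt (w (m + 1)) (rhsR α β γ N (w m) t) t) {M C : ℝ}
    (hM : ∀ m, ∀ t ∈ Icc (-1 : ℝ) 1, |w m t| ≤ M)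
    (hd : ∀ m, ∀ t ∈ Icc (-1 : ℝ) 1, |w (m + 1) t - w m t| ≤ C * (9 / 16) ^ m) (t : ℝ) :
    HasDerivAt (fun t => ∑' m, (w (m + 1) t - w m t))
      (rhsR α β γ N (fun t => ∑' m, (w (m + 1) t - w m t)) t) t := by
  set u : ℝ → ℝ := fun t => ∑' m, (w (m + 1) t - w m t) with hu
  have hM0 : 0 ≤ M := (abs_nonneg _).trans (hM 0 0 (by simp))
  have hC0 : 0 ≤ C := by
    have := (abs_nonneg _).trans (hd 0 0 (by simp))
    simpa using this
  have hgeo : Summable (fun m : ℕ => ((9 : ℝ) / 16) ^ m) :=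
    summable_geometric_of_lt_one (by norm_num) (by norm_num)
  -- convergence on the interval
  have hlim : ∀ s ∈ Icc (-1 : ℝ) 1, Filter.Tendsto (fun m => w m s) Filter.atTop (nhds (u s)) := by
    intro s hs
    have h1 : Summable (fun m => w (m + 1) s - w m s) :=
      Summable.of_norm_bounded (hgeo.mul_left C) (fun m => hd m s hs)
    have h2 := h1.hasSum.tendsto_sum_nat
    simpa [Finset.sum_range_sub (fun m => w m s), h0] using h2
  set D : ℕ → ℝ → ℝ := fun m s => match m with
    | 0 => rhsR α β γ N (w 0) s
    | (k + 1) => rhsR α β γ N (w (k + 1)) s - rhsR α β γ N (w k) s with hD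
  have hder : ∀ m s, HasDerivAt (fun s => w (m + 1) s - w m s) (D m s) s := by
    intro m s
    cases m with
    | zero =>
      have h1 := hw 0 s
      have h2 : (fun s => w (0 + 1) s - w 0 s) = w (0 + 1) := by funext s; simp [h0]
      rw [h2]
      exact h1
    | succ k => exact (hw (k + 1) s).sub (hw k s)
  set R : ℝ := |t| + 1 with hR
  have hR0 : 0 < R := by positivity
  have hbound : ∀ m, ∀ s ∈ Ioo (-R) R, ‖D m s‖ ≤
      (β ^ 2 + 1) * Real.cosh (γ * R) * (9 / 16) ^ m
        + 2 * (|α| * R ^ N * (3 * M ^ 2 * C)) * (9 / 16) ^ m := by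
    intro m s hs
    have hsR : |s| ≤ R := abs_le.2 ⟨hs.1.le, hs.2.le⟩
    cases m with
    | zero =>
      have h1 : Real.cosh (γ * s) ≤ Real.cosh (γ * R) := by
        rw [Real.cosh_le_cosh, abs_mul, abs_mul, abs_of_pos hR0]; gcongr
      have h2 : 0 ≤ 2 * (|α| * R ^ N * (3 * M ^ 2 * C)) := by positivity
      have h3 : |β| ≤ β ^ 2 + 1 := by
        rw [← sq_abs]; nlinarith [sq_nonneg (|β| - 1), abs_nonneg β]
      have h4 : ‖D 0 s‖ ≤ (β ^ 2 + 1) * Real.cosh (γ * R) := by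
        simp only [hD, rhsR, h0, Pi.zero_apply, Real.norm_eq_abs]
        rw [zero_pow (by norm_num), mul_zero, zero_add, abs_mul, abs_of_pos (Real.cosh_pos _)]
        gcongr
      simp only [pow_zero, mul_one]
      linarith
    | succ k =>
      have e : D (k + 1) s = α * s ^ N * (w (k + 1) (Real.sin s) ^ 3 - w k (Real.sin s) ^ 3) := by
        simp only [hD, rhsR]; ring
      have h1 : |w (k + 1) (Real.sin s) ^ 3 - w k (Real.sin s) ^ 3|
          ≤ 3 * M ^ 2 * (C * (9 / 16) ^ k) := by
        have := cube_bound (p := (w (k + 1) (Real.sin s) : ℂ)) (r := (w k (Real.sin s) : ℂ))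
          (M := M) (δ := C * (9 / 16) ^ k)
          (by rw [Complex.norm_real]; exact hM _ _ (sin_mem s))
          (by rw [Complex.norm_real]; exact hM _ _ (sin_mem s))
          (by rw [← Complex.ofReal_sub, Complex.norm_real]; exact hd _ _ (sin_mem s))
        rw [← Complex.ofReal_pow, ← Complex.ofReal_pow, ← Complex.ofReal_sub,
          Complex.norm_real] at this
        exact this
      have h2 : 0 ≤ (β ^ 2 + 1) * Real.cosh (γ * R) * (9 / 16) ^ (k + 1) := by
        have := Real.cosh_pos (γ * R)
        positivity
      have h3 : 0 ≤ |α| * R ^ N * (3 * M ^ 2 * (C * (9 / 16) ^ k)) := by positivity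
      have h4 : ‖D (k + 1) s‖ ≤ |α| * R ^ N * (3 * M ^ 2 * (C * (9 / 16) ^ k)) := by
        rw [e, Real.norm_eq_abs, abs_mul, abs_mul, abs_pow]
        gcongr
      have h5 : 2 * (|α| * R ^ N * (3 * M ^ 2 * C)) * (9 / 16) ^ (k + 1)
          = (9 / 8) * (|α| * R ^ N * (3 * M ^ 2 * (C * (9 / 16) ^ k))) := by ring
      rw [h5]
      linarith
  have hsum : Summable (fun m : ℕ => (β ^ 2 + 1) * Real.cosh (γ * R) * (9 / 16) ^ m
        + 2 * (|α| * R ^ N * (3 * M ^ 2 * C)) * (9 / 16) ^ m) :=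
    (hgeo.mul_left _).add (hgeo.mul_left _)
  have htR : t ∈ Ioo (-R) R := by
    constructor
    · linarith [neg_abs_le t]
    · linarith [le_abs_self t]
  have key := hasDerivAt_tsum_of_isPreconnected hsum isOpen_Ioo
    (isPreconnected_Ioo) (fun m s _ => hder m s) hbound (y₀ := 0) (by simp [hR0])
    (by simp [hw0]) htR
  have hDs : Summable (fun m => D m t) := Summable.of_norm_bounded hsum (fun m => hbound m t htR)
  have hpart : ∀ n, ∑ m ∈ Finset.range (n + 1), D m t = rhsR α β γ N (w n) t := by
    intro n
    induction n with
    | zero => simp [hD]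
    | succ n ih => rw [Finset.sum_range_succ, ih]; simp [hD]
  have hT1 := (Filter.tendsto_add_atTop_iff_nat 1).2 hDs.hasSum.tendsto_sum_nat
  simp only [hpart] at hT1
  have hT2 : Filter.Tendsto (fun n => rhsR α β γ N (w n) t) Filter.atTop
      (nhds (rhsR α β γ N u t)) := by
    unfold rhsR
    exact (((hlim _ (sin_mem t)).pow 3).const_mul _).add_const _
  rw [← tendsto_nhds_unique hT1 hT2]
  exact key

lemma smooth_of_ode {u : ℝ → ℝ} (hu : ∀ t, HasDerivAt u (rhsR α β γ N u t) t) :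
    ContDiff ℝ (⊤ : ℕ∞) u := by
  have hder : deriv u = rhsR α β γ N u := funext fun t => (hu t).deriv
  have : ∀ n : ℕ, ContDiff ℝ n u := by
    intro n
    induction n with
    | zero => exact contDiff_zero.2 (continuous_iff_continuousAt.2 fun t => (hu t).continuousAt)
    | succ n ih =>
      push_cast
      refine contDiff_succ_iff_deriv.2 ⟨fun t => (hu t).differentiableAt, by simp, ?_⟩
      rw [hder]
      unfold rhsR
      have := ih.comp (Real.contDiff_sin (n := n))
      simp only [Function.comp_def] at this
      fun_prop
  exact contDiff_infty.2 this

lemma iter_re {f : ℂ → ℂ} (hf : Differentiable ℂ f) (n : ℕ) (t : ℝ) :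
    HasDerivAt (fun t : ℝ => (iteratedDeriv n f t).re) (iteratedDeriv (n + 1) f t).re t := by
  have h1 : Differentiable ℂ (iteratedDeriv n f) :=
    (hf.contDiff (n := ⊤)).differentiable_iteratedDeriv n (by exact_mod_cast WithTop.coe_lt_top _)
  have := (h1 t).hasDerivAt.real_of_complex
  rwa [← iteratedDeriv_succ] at this

lemma cauchy_bound {f : ℂ → ℂ} (hf : Differentiable ℂ f) {r C : ℝ} (hr : 0 < r)
    (hC : ∀ z ∈ Box r, ‖f z‖ ≤ C) (n : ℕ) {t : ℝ} (ht : t ∈ Icc (-1 : ℝ) 1) :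
    |(iteratedDeriv n f t).re| ≤ n.factorial * C / r ^ n := by
  refine (Complex.abs_re_le_norm _).trans ?_
  refine Complex.norm_iteratedDeriv_le_of_forall_mem_sphere_norm_le n hr hf.diffContOnCl ?_
  intro z hz
  apply hC
  have h1 : ‖z - t‖ = r := by simpa [dist_eq_norm] using hz
  have h2 := Complex.abs_re_le_norm (z - t)
  have h3 := Complex.abs_im_le_norm (z - t)
  simp only [Complex.sub_re, Complex.sub_im, Complex.ofReal_re, Complex.ofReal_im, sub_zero] at h2 h3
  rw [h1] at h2 h3
  refine ⟨?_, h3⟩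
  have h4 : |t| ≤ 1 := abs_le.2 ht
  have := abs_add_le (z.re - t) t
  rw [sub_add_cancel] at this
  linarith

lemma geom_pow_bound (m n : ℕ) :
    ((9 : ℝ) / 16) ^ m * ((m : ℝ) + 2) ^ n ≤
      4 ^ n * n.factorial * Real.exp (1 / 2) * Real.exp (-(1 / 4)) ^ m := by
  have h1 : (9 : ℝ) / 16 ≤ Real.exp (-(1 / 4)) ^ 2 := by
    have := Real.add_one_le_exp (-(1 / 4) : ℝ)
    norm_num at this ⊢
    nlinarith
  have h2 := Real.pow_div_factorial_le_exp (x := ((m : ℝ) + 2) / 4) (by positivity) n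
  rw [div_le_iff₀ (by positivity), div_pow, div_le_iff₀ (by positivity)] at h2
  have h3 : Real.exp (((m : ℝ) + 2) / 4) * Real.exp (-(1 / 4)) ^ m = Real.exp (1 / 2) := by
    rw [← Real.exp_nat_mul, ← Real.exp_add]
    congr 1
    ring
  calc ((9 : ℝ) / 16) ^ m * ((m : ℝ) + 2) ^ n
      ≤ (Real.exp (-(1 / 4)) ^ 2) ^ m * (Real.exp (((m : ℝ) + 2) / 4) * n.factorial * 4 ^ n) := by
        gcongr
    _ = 4 ^ n * n.factorial * (Real.exp (((m : ℝ) + 2) / 4) * Real.exp (-(1 / 4)) ^ m)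
          * Real.exp (-(1 / 4)) ^ m := by ring
    _ = _ := by rw [h3]

lemma gevrey_of_series {f : ℕ → ℂ → ℂ} (hf : ∀ m, Differentiable ℂ (f m)) {a C : ℝ} (ha : 0 < a)
    (hC0 : 0 ≤ C)
    (hC : ∀ m, ∀ z ∈ Box (rad a (m + 1)), ‖f m z‖ ≤ C * (9 / 16) ^ m)
    {u : ℝ → ℝ} (hu : ContDiff ℝ (⊤ : ℕ∞) u) (hs : ∀ t, u t = ∑' m, (f m t).re) :
    GevreyOn 1 u := by
  set q : ℝ := Real.exp (-(1 / 4)) with hq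
  have hq0 : 0 < q := Real.exp_pos _
  have hq1 : q < 1 := by rw [hq, Real.exp_lt_one_iff]; norm_num
  have hgeo : Summable (fun m : ℕ => q ^ m) := summable_geometric_of_lt_one hq0.le hq1
  set A : ℕ → ℝ := fun n => (n.factorial : ℝ) ^ 2 * (4 / a) ^ n * (C * Real.exp (1 / 2)) with hA
  have hterm : ∀ n m, ∀ t ∈ Icc (-1 : ℝ) 1, |(iteratedDeriv n (f m) t).re| ≤ A n * q ^ m := by
    intro n m t ht
    refine (cauchy_bound (hf m) (rad_pos ha _) (hC m) n ht).trans ?_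
    have e : (n.factorial : ℝ) * (C * (9 / 16) ^ m) / rad a (m + 1) ^ n
        = n.factorial * C / a ^ n * ((9 / 16) ^ m * ((m : ℝ) + 2) ^ n) := by
      unfold rad
      push_cast
      have : (m : ℝ) + 1 + 1 = m + 2 := by ring
      have h2 : (m : ℝ) + 2 ≠ 0 := by positivity
      rw [this, div_pow a, div_div_eq_mul_div]
      ring
    rw [e]
    calc _ ≤ n.factorial * C / a ^ n *
          (4 ^ n * n.factorial * Real.exp (1 / 2) * q ^ m) := by
          exact mul_le_mul_of_nonneg_left (geom_pow_bound m n) (by positivity)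
      _ = _ := by simp only [hA, div_pow]; ring
  have hsumm : ∀ n, Summable (fun m => A n * q ^ m) := fun n => hgeo.mul_left _
  have hiter : ∀ n, ∀ t ∈ Ioo (-1 : ℝ) 1,
      iteratedDeriv n u t = ∑' m, (iteratedDeriv n (f m) t).re := by
    intro n
    induction n with
    | zero => intro t _; simp [hs]
    | succ n ih =>
      intro t ht
      rw [iteratedDeriv_succ]
      have h1 := hasDerivAt_tsum_of_isPreconnected (hsumm (n + 1)) isOpen_Ioo
        isPreconnected_Ioo (fun m s _ => iter_re (hf m) n s)
        (fun m s hs => hterm (n + 1) m s (Ioo_subset_Icc_self hs)) (y₀ := t) ht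
        (Summable.of_norm_bounded (hsumm n) (fun m => hterm n m t (Ioo_subset_Icc_self ht))) ht
      rw [← h1.deriv]
      apply Filter.EventuallyEq.deriv_eq
      filter_upwards [isOpen_Ioo.mem_nhds ht] with s hs using ih s hs
  set S : ℝ := ∑' m : ℕ, q ^ m with hS
  have hS0 : 0 ≤ S := tsum_nonneg (fun m => by positivity)
  have hopen : ∀ n, ∀ t ∈ Ioo (-1 : ℝ) 1, |iteratedDeriv n u t| ≤ A n * S := by
    intro n t ht
    rw [hiter n t ht, hS, ← tsum_mul_left]
    exact tsum_of_norm_bounded (f := fun m => (iteratedDeriv n (f m) t).re) (hsumm n).hasSum (fun m => hterm n m t (Ioo_subset_Icc_self ht))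
  have hclosed : ∀ n, ∀ t ∈ Icc (-1 : ℝ) 1, |iteratedDeriv n u t| ≤ A n * S := by
    intro n t ht
    have hc : Continuous (iteratedDeriv n u) := hu.continuous_iteratedDeriv n (by exact_mod_cast le_top)
    refine le_on_closure (s := Ioo (-1 : ℝ) 1) (hopen n) hc.abs.continuousOn continuousOn_const ?_
    rwa [closure_Ioo (by norm_num)]
  refine ⟨hu.contDiffOn, C * Real.exp (1 / 2) * S + 4 / a, by positivity, ?_⟩
  intro n x hx
  rw [iteratedDerivWithin_eq_iteratedDeriv (uniqueDiffOn_Icc (by norm_num))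
    (hu.contDiffAt.of_le (by exact_mod_cast le_top)) hx]
  refine (hclosed n x hx).trans ?_
  have hfac : (n.factorial : ℝ) ^ 2 ≤ (n : ℝ) ^ ((n : ℝ) * (1 + 1 / 1)) := by
    have h1 : (n.factorial : ℝ) ≤ (n : ℝ) ^ n := by exact_mod_cast Nat.factorial_le_pow n
    have h2 : (n : ℝ) ^ ((n : ℝ) * (1 + 1 / 1)) = ((n : ℝ) ^ n) ^ 2 := by
      rw [← pow_mul, ← Real.rpow_natCast]
      congr 1
      push_cast
      norm_num
    rw [h2]
    gcongr
  have hE : 0 ≤ C * Real.exp (1 / 2) * S := by positivity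
  have h4 : 0 ≤ 4 / a := by positivity
  calc A n * S = (4 / a) ^ n * (C * Real.exp (1 / 2) * S) * (n.factorial : ℝ) ^ 2 := by
        simp only [hA]; ring
    _ ≤ (C * Real.exp (1 / 2) * S + 4 / a) ^ n * (C * Real.exp (1 / 2) * S + 4 / a)
          * (n : ℝ) ^ ((n : ℝ) * (1 + 1 / 1)) := by
        gcongr <;> linarith
    _ = _ := by rw [pow_succ]

end real

lemma exists_width {γ : ℝ} (hγ : 0 < γ) (N : ℕ) : ∃ a : ℝ, 0 < a ∧ a ≤ 1 / 10 ∧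
    (1 + 2 * a) ^ (N + 1) ≤ 2 ∧
    Real.sinh (γ * (1 + a)) + Real.cosh (γ * (1 + a)) * (γ * a) ≤ 2 * Real.sinh γ := by
  have hs : 0 < Real.sinh γ := Real.sinh_pos_iff.2 hγ
  have h1 : ∀ᶠ a : ℝ in nhds 0, (1 + 2 * a) ^ (N + 1) < 2 := by
    have : ContinuousAt (fun a : ℝ => (1 + 2 * a) ^ (N + 1)) 0 := by fun_prop
    exact this.eventually_lt continuousAt_const (by simp)
  have h2 : ∀ᶠ a : ℝ in nhds 0,
      Real.sinh (γ * (1 + a)) + Real.cosh (γ * (1 + a)) * (γ * a) < 2 * Real.sinh γ := by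
    have : ContinuousAt (fun a : ℝ =>
        Real.sinh (γ * (1 + a)) + Real.cosh (γ * (1 + a)) * (γ * a)) 0 := by fun_prop
    exact this.eventually_lt continuousAt_const (by simp; linarith)
  have h3 : ∀ᶠ a : ℝ in nhds 0, a < 1 / 10 := eventually_lt_nhds (by norm_num)
  have h4 := (h1.and (h2.and h3)).filter_mono (nhdsWithin_le_nhds (s := Ioi (0 : ℝ)))
  obtain ⟨a, ⟨ha1, ha2, ha3⟩, ha0⟩ := (h4.and self_mem_nhdsWithin).exists
  exact ⟨a, ha0, ha3.le, ha1.le, ha2.le⟩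

/-- Example 1: if `(2β/γ) sinh γ < √((N+1)/(24|α|))`, then the FDE
`y′(t) = α t^N (y(sin t))³ + β cosh(γ t)` on `[-1,1]` with `y(0) = 0` has a solution in
the Gevrey class `G₁([-1,1])`. -/
theorem stmt13 (α β γ : ℝ) (hα : α ≠ 0) (hβ : 0 < β) (hγ : 0 < γ) (N : ℕ)
    (h : (2 * β / γ) * Real.sinh γ < Real.sqrt (((N:ℝ) + 1) / (24 * |α|))) :
    ∃ u : ℝ → ℝ, GevreyOn 1 u ∧ u 0 = 0 ∧
      ∀ t ∈ Icc (-1:ℝ) 1,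
        HasDerivWithinAt u
          (α * t ^ N * (u (Real.sin t)) ^ 3 + β * Real.cosh (γ * t))
          (Icc (-1:ℝ) 1) t := by
  obtain ⟨a, ha, ha1, hN, hs⟩ := exists_width hγ N
  obtain ⟨y, h0, hy0, hyd, hy⟩ := exists_picard α β γ N
  obtain ⟨σ, hσ⟩ : ∃ σ : ℝ, σ = 2 * β / γ * Real.sinh γ := ⟨_, rfl⟩
  have hα' : 0 < |α| := abs_pos.2 hα
  have hσ0 : 0 ≤ σ := by
    have := Real.sinh_nonneg_iff.2 hγ.le
    rw [hσ]; positivity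
  have hσ1 : 24 * (|α| / (N + 1)) * σ ^ 2 ≤ 1 := by
    rw [← hσ, Real.lt_sqrt hσ0, lt_div_iff₀ (by positivity)] at h
    have : 24 * (|α| / ((N : ℝ) + 1)) * σ ^ 2 = σ ^ 2 * (24 * |α|) / (N + 1) := by ring
    rw [this, div_le_one (by positivity)]
    exact h.le
  have hb := picard_bound hγ hβ ha ha1 hσ hσ1 hN hs h0 hy0 hy
  have hd := picard_diff hσ0 ha ha1 hσ1 hN hy0 hy hb
  have him := picard_real h0 hy0 hy
  have hbox : ∀ m, ∀ t ∈ Icc (-1 : ℝ) 1, (t : ℂ) ∈ Box (rad a m) := by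
    intro m t ht
    have h1 : |t| ≤ 1 := abs_le.2 ht
    have h2 := rad_pos ha m
    constructor
    · simp only [Complex.ofReal_re]; linarith
    · simp only [Complex.ofReal_im, abs_zero]; exact h2.le
  have hode := limit_ode (w := fun m t => (y m t).re) (M := 3 / 2 * σ) (C := 3 * σ)
    (by funext t; simp [h0]) (by intro m; simp [hy0]) (picard_real_deriv him hy)
    (fun m t ht => (Complex.abs_re_le_norm _).trans (hb m t (hbox m t ht)))
    (fun m t ht => by
      rw [← Complex.sub_re]
      exact (Complex.abs_re_le_norm _).trans (hd m t (hbox (m + 1) t ht)))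
  refine ⟨_, gevrey_of_series (f := fun m z => y (m + 1) z - y m z)
    (fun m => (hyd (m + 1)).sub (hyd m)) ha (C := 3 * σ) (by positivity) hd
    (smooth_of_ode hode) (fun t => by simp), by simp [hy0], fun t _ => (hode t).hasDerivWithinAt⟩
end

section
/- The functional differential equation y′(t) = 2·ln 2·2^t · ((y(sin t))⁴ − (y(sin t))² + (1/8)·y(sin t) − 1) + (301·ln 2/150)·2^t on [-1,1] with initial condition y(0) = 1/100 has a solution belonging to the Gevrey class G₁([-1,1]). -/
open Set

namespace GevreyEx

/-- Radii. -/
noncomputable def rad (n : ℕ) : ℝ := 1 / (100 * ((n : ℝ) + 1))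

/-- Complex neighbourhoods of `[-1,1]`. -/
def A (r : ℝ) : Set ℂ := {z | |z.re| < 101 / 100 ∧ |z.im| < r}

lemma rad_pos (n : ℕ) : 0 < rad n := by unfold rad; positivity

lemma rad_le (n : ℕ) : rad n ≤ 1 / 100 := by
  unfold rad
  apply one_div_le_one_div_of_le (by norm_num)
  have : (0 : ℝ) ≤ n := Nat.cast_nonneg n
  linarith

lemma rad_step (n : ℕ) : rad (n + 1) + rad (n + 1) ^ 2 ≤ rad n := by
  unfold rad
  push_cast
  have : (0 : ℝ) ≤ n := Nat.cast_nonneg n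
  have h : 1 / (100 * ((n : ℝ) + 1)) - (1 / (100 * ((n : ℝ) + 1 + 1)) + (1 / (100 * ((n : ℝ) + 1 + 1))) ^ 2)
      = (99 * n + 199) / (10000 * (n + 1) * (n + 2) ^ 2) := by
    field_simp
    ring
  have : 0 ≤ (99 * (n : ℝ) + 199) / (10000 * (n + 1) * (n + 2) ^ 2) := by positivity
  linarith

lemma A_mono {r s : ℝ} (h : r ≤ s) : A r ⊆ A s := fun _ hz => ⟨hz.1, hz.2.trans_le h⟩

lemma A_convex (r : ℝ) : Convex ℝ (A r) := by
  have h1 : A r = Complex.reLm ⁻¹' (Metric.ball 0 (101 / 100)) ∩ Complex.imLm ⁻¹' (Metric.ball 0 r) := by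
    ext z
    simp [A]
  rw [h1]
  exact ((convex_ball _ _).linear_preimage _).inter ((convex_ball _ _).linear_preimage _)

lemma zero_mem_A {r : ℝ} (h : 0 < r) : (0 : ℂ) ∈ A r := by
  simp [A, h]

lemma sin_mem {n : ℕ} {z : ℂ} (hz : z ∈ A (rad (n + 1))) : Complex.sin z ∈ A (rad n) := by
  obtain ⟨-, h2⟩ := hz
  have hr := rad_le (n + 1)
  have hy : |z.im| ≤ 1 := by linarith
  have e1 := abs_le.1 (Real.abs_exp_sub_one_sub_id_le hy)
  have e2 := abs_le.1 (Real.abs_exp_sub_one_sub_id_le (x := -z.im) (by simpa using hy))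
  have hsq : z.im ^ 2 < rad (n + 1) ^ 2 := by
    rw [← sq_abs]; exact pow_lt_pow_left₀ h2 (abs_nonneg _) (by norm_num)
  have hre : (Complex.sin z).re = Real.sin z.re * Real.cosh z.im := by
    rw [Complex.sin_eq]
    simp [← Complex.ofReal_sin, ← Complex.ofReal_cos, ← Complex.ofReal_sinh, ← Complex.ofReal_cosh]
  have him : (Complex.sin z).im = Real.cos z.re * Real.sinh z.im := by
    rw [Complex.sin_eq]
    simp [← Complex.ofReal_sin, ← Complex.ofReal_cos, ← Complex.ofReal_sinh, ← Complex.ofReal_cosh]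
  constructor
  · rw [hre, abs_mul, abs_of_pos (Real.cosh_pos _)]
    have : Real.cosh z.im < 101 / 100 := by
      rw [Real.cosh_eq]
      have := rad_pos (n + 1)
      nlinarith
    have h3 := Real.abs_sin_le_one z.re
    have h4 := Real.cosh_pos z.im
    nlinarith
  · rw [him, abs_mul]
    have : |Real.sinh z.im| < rad n := by
      refine lt_of_lt_of_le ?_ (rad_step n)
      have h5 : |Real.sinh z.im| ≤ |z.im| + z.im ^ 2 := by
        have : |Real.sinh z.im - z.im| ≤ z.im ^ 2 := by
          rw [Real.sinh_eq, abs_le]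
          constructor <;> nlinarith
        have := abs_sub_abs_le_abs_sub (Real.sinh z.im) z.im
        linarith
      linarith
    have h3 := Real.abs_cos_le_one z.re
    have h4 := abs_nonneg (Real.sinh z.im)
    nlinarith

/-- The reduced polynomial. -/
noncomputable def Q (w : ℂ) : ℂ := w ^ 4 - w ^ 2 + (1 / 8) * w

/-- The prefactor. -/
noncomputable def E (z : ℂ) : ℂ := Complex.exp ((Real.log 2 : ℝ) * z) * (Real.log 2 : ℝ)

/-- Right-hand side. -/
noncomputable def G (f : ℂ → ℂ) (z : ℂ) : ℂ := E z * (2 * Q (f (Complex.sin z)) + 1 / 150)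

lemma Q_bound {w : ℂ} (hw : ‖w‖ ≤ 1 / 20) : ‖Q w‖ ≤ 88 / 10000 := by
  have h0 := norm_nonneg w
  have : ‖Q w‖ ≤ ‖w‖ ^ 4 + ‖w‖ ^ 2 + (1 / 8) * ‖w‖ := by
    unfold Q
    refine (norm_add_le _ _).trans (add_le_add ((norm_sub_le _ _).trans (by simp)) (by simp))
  have h2 : ‖w‖ ^ 2 ≤ (1 / 20) ^ 2 := pow_le_pow_left₀ h0 hw 2
  have h4 : ‖w‖ ^ 4 ≤ (1 / 20) ^ 4 := pow_le_pow_left₀ h0 hw 4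
  linarith

lemma Q_lip {w v : ℂ} (hw : ‖w‖ ≤ 1 / 20) (hv : ‖v‖ ≤ 1 / 20) :
    ‖Q w - Q v‖ ≤ 226 / 1000 * ‖w - v‖ := by
  have h : Q w - Q v = ((w + v) * (w ^ 2 + v ^ 2) - (w + v) + 1 / 8) * (w - v) := by
    unfold Q; ring
  rw [h, norm_mul]
  apply mul_le_mul_of_nonneg_right _ (norm_nonneg _)
  have h1 : ‖w + v‖ ≤ 1 / 10 := (norm_add_le _ _).trans (by linarith)
  have h2 : ‖w ^ 2 + v ^ 2‖ ≤ 1 / 200 := by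
    refine (norm_add_le _ _).trans ?_
    rw [norm_pow, norm_pow]
    have := pow_le_pow_left₀ (norm_nonneg w) hw 2
    have := pow_le_pow_left₀ (norm_nonneg v) hv 2
    linarith
  have h3 : ‖(w + v) * (w ^ 2 + v ^ 2)‖ ≤ 1 / 10 * (1 / 200) := by
    rw [norm_mul]; gcongr
  calc _ ≤ ‖(w + v) * (w ^ 2 + v ^ 2)‖ + ‖w + v‖ + ‖(1 / 8 : ℂ)‖ :=
        (norm_add_le _ _).trans (add_le_add (norm_sub_le _ _) le_rfl)
    _ ≤ _ := by
        have : ‖(1 / 8 : ℂ)‖ = 1 / 8 := by simp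
        rw [this]; linarith

lemma E_bound {r : ℝ} {z : ℂ} (hz : z ∈ A r) : ‖E z‖ ≤ 1401 / 1000 := by
  have hl := Real.log_two_lt_d9
  have hl0 : 0 < Real.log 2 := Real.log_pos (by norm_num)
  unfold E
  rw [norm_mul, Complex.norm_exp, Complex.norm_real, Real.norm_of_nonneg hl0.le]
  have h1 : ((Real.log 2 : ℝ) * z : ℂ).re = Real.log 2 * z.re := Complex.re_ofReal_mul _ _
  rw [h1]
  have h2 : Real.exp (Real.log 2 * z.re) ≤ 2 * (1 / (1 - 7 / 1000)) := by
    have h3 : Real.log 2 * z.re ≤ Real.log 2 + 7 / 1000 := by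
      have := (abs_lt.1 hz.1).2
      nlinarith
    calc _ ≤ Real.exp (Real.log 2 + 7 / 1000) := Real.exp_le_exp.2 h3
      _ = 2 * Real.exp (7 / 1000) := by rw [Real.exp_add, Real.exp_log (by norm_num)]
      _ ≤ _ := by
        gcongr
        exact Real.exp_bound_div_one_sub_of_interval (by norm_num) (by norm_num)
  have h4 := Real.exp_pos (Real.log 2 * z.re)
  calc _ ≤ (2 * (1 / (1 - 7 / 1000))) * 0.6931471808 :=
        mul_le_mul h2 hl.le hl0.le (by norm_num)
    _ ≤ 1401 / 1000 := by norm_num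

lemma norm_le_of_mem {r : ℝ} (hr : r ≤ 1 / 100) {z : ℂ} (hz : z ∈ A r) : ‖z‖ ≤ 102 / 100 := by
  have := Complex.norm_le_abs_re_add_abs_im z
  have := hz.1
  have := hz.2
  linarith

lemma G_diff {f : ℂ → ℂ} (hf : Differentiable ℂ f) : Differentiable ℂ (G f) := by
  have h1 : Differentiable ℂ (fun z => f (Complex.sin z)) := hf.comp Complex.differentiable_sin
  unfold G E Q
  fun_prop

lemma exists_prim (g : ℂ → ℂ) : ∃ F : ℂ → ℂ, Differentiable ℂ g →
    (∀ z, HasDerivAt F (g z) z) ∧ F 0 = 1 / 100 := by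
  by_cases hg : Differentiable ℂ g
  · obtain ⟨F, h1, h2⟩ := hg.isExactOn_univ.with_val_at 0 (1 / 100)
    exact ⟨F, fun _ => ⟨fun z => h2 z trivial, h1⟩⟩
  · exact ⟨0, fun h => absurd h hg⟩

/-- A primitive with value `1/100` at zero. -/
noncomputable def prim (g : ℂ → ℂ) : ℂ → ℂ := (exists_prim g).choose

/-- Picard iterates. -/
noncomputable def f : ℕ → ℂ → ℂ
  | 0 => fun _ => 1 / 100
  | n + 1 => prim (G (f n))

lemma f_diff (n : ℕ) : Differentiable ℂ (f n) := by
  induction n with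
  | zero => simp only [f]; fun_prop
  | succ n ih =>
    intro z
    exact (((exists_prim (G (f n))).choose_spec (G_diff ih)).1 z).differentiableAt

lemma f_deriv (n : ℕ) (z : ℂ) : HasDerivAt (f (n + 1)) (G (f n) z) z :=
  ((exists_prim (G (f n))).choose_spec (G_diff (f_diff n))).1 z

lemma f_zero (n : ℕ) : f n 0 = 1 / 100 := by
  cases n with
  | zero => simp [f]
  | succ n => exact ((exists_prim (G (f n))).choose_spec (G_diff (f_diff n))).2

lemma f_bound (n : ℕ) : ∀ z ∈ A (rad n), ‖f n z‖ ≤ 1 / 20 := by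
  induction n with
  | zero => intro z _; simp only [f]; norm_num
  | succ n ih =>
    intro z hz
    have hb : ∀ w ∈ A (rad (n + 1)), ‖G (f n) w‖ ≤ 1401 / 1000 * (2 * (88 / 10000) + 1 / 150) := by
      intro w hw
      unfold G
      rw [norm_mul]
      have h1 := E_bound hw
      have h2 := Q_bound (ih _ (sin_mem hw))
      have h3 : ‖2 * Q (f n (Complex.sin w)) + 1 / 150‖ ≤ 2 * (88 / 10000) + 1 / 150 := by
        refine (norm_add_le _ _).trans ?_
        rw [norm_mul]
        have : ‖(1 / 150 : ℂ)‖ = 1 / 150 := by simp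
        rw [this, Complex.norm_two]
        linarith
      gcongr
    have := (A_convex (rad (n + 1))).norm_image_sub_le_of_norm_hasDerivWithin_le
      (fun w _ => (f_deriv n w).hasDerivWithinAt) hb (zero_mem_A (rad_pos _)) hz
    rw [f_zero, sub_zero] at this
    have h5 := norm_le_of_mem (rad_le _) hz
    have h6 : ‖f (n + 1) z‖ ≤ ‖f (n + 1) z - 1 / 100‖ + ‖(1 / 100 : ℂ)‖ := by
      simpa using norm_add_le (f (n + 1) z - 1 / 100) (1 / 100)
    have h7 : ‖(1 / 100 : ℂ)‖ = 1 / 100 := by simp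
    rw [h7] at h6
    linarith

lemma f_sub (n : ℕ) : ∀ z ∈ A (rad (n + 1)), ‖f (n + 1) z - f n z‖ ≤ (2 / 3) ^ (n + 1) := by
  induction n with
  | zero =>
    intro z hz
    have h1 := f_bound 1 z hz
    have h2 := f_bound 0 z (A_mono (by nlinarith [rad_step 0, rad_pos 1]) hz)
    refine (norm_sub_le _ _).trans ?_
    norm_num at *
    linarith
  | succ n ih =>
    intro z hz
    have hstep : rad (n + 1) ≤ rad n := by nlinarith [rad_step n, rad_pos (n + 1)]
    have hb : ∀ w ∈ A (rad (n + 1 + 1)), ‖G (f (n + 1)) w - G (f n) w‖ ≤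
        1401 / 1000 * (2 * (226 / 1000 * (2 / 3) ^ (n + 1))) := by
      intro w hw
      have hs := sin_mem hw
      have h : G (f (n + 1)) w - G (f n) w
          = E w * (2 * (Q (f (n + 1) (Complex.sin w)) - Q (f n (Complex.sin w)))) := by
        unfold G; ring
      rw [h, norm_mul, norm_mul, Complex.norm_two]
      have h1 := E_bound hw
      have h2 := Q_lip (f_bound _ _ hs) (f_bound _ _ (A_mono hstep hs))
      have h3 := ih _ hs
      have h4 : ‖Q (f (n + 1) (Complex.sin w)) - Q (f n (Complex.sin w))‖ ≤
        226 / 1000 * (2 / 3) ^ (n + 1) := h2.trans (by gcongr)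
      gcongr
    have := (A_convex (rad (n + 1 + 1))).norm_image_sub_le_of_norm_hasDerivWithin_le
      (fun w _ => ((f_deriv (n + 1) w).sub (f_deriv n w)).hasDerivWithinAt) hb
      (zero_mem_A (rad_pos _)) hz
    simp only [Pi.sub_apply] at this
    rw [f_zero, f_zero, sub_zero, sub_self, sub_zero] at this
    have h5 := norm_le_of_mem (rad_le _) hz
    have h6 : (0 : ℝ) < (2 / 3) ^ (n + 1) := by positivity
    refine this.trans ?_
    rw [pow_succ (2 / 3 : ℝ) (n + 1)]
    nlinarith

/-- Increments. -/
noncomputable def D : ℕ → ℂ → ℂ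
  | 0 => f 0
  | n + 1 => fun z => f (n + 1) z - f n z

lemma D_diff (n : ℕ) : Differentiable ℂ (D n) := by
  cases n with
  | zero => exact f_diff 0
  | succ n => exact (f_diff (n + 1)).sub (f_diff n)

lemma D_bound (n : ℕ) : ∀ z ∈ A (rad n), ‖D n z‖ ≤ (2 / 3) ^ n := by
  cases n with
  | zero => intro z hz; exact (f_bound 0 z hz).trans (by norm_num)
  | succ n => exact f_sub n

lemma D_sum (n : ℕ) (z : ℂ) : ∑ i ∈ Finset.range (n + 1), D i z = f n z := by
  induction n with
  | zero => simp [D]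
  | succ n ih => rw [Finset.sum_range_succ, ih]; simp [D]

lemma f_real (n : ℕ) : ∀ x : ℝ, (f n x).im = 0 := by
  induction n with
  | zero => intro x; simp [f]
  | succ n ih =>
    have hG : ∀ x : ℝ, (G (f n) x).im = 0 := by
      intro x
      have hs : f n (Complex.sin x) = ((f n (Complex.sin x)).re : ℝ) := by
        apply Complex.ext
        · simp
        · rw [← Complex.ofReal_sin, ih]; simp
      have : G (f n) x = ((Real.exp (Real.log 2 * x) * Real.log 2 *
          (2 * ((f n (Complex.sin x)).re ^ 4 - (f n (Complex.sin x)).re ^ 2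
            + (1 / 8) * (f n (Complex.sin x)).re) + 1 / 150) : ℝ) : ℂ) := by
        unfold G E Q
        rw [hs]
        push_cast
        simp
      rw [this, Complex.ofReal_im]
    have hd : ∀ x : ℝ, HasDerivAt (fun x : ℝ => (f (n + 1) x).im) 0 x := by
      intro x
      have h1 := (f_deriv n (x : ℂ)).comp_ofReal
      have h2 := Complex.imCLM.hasFDerivAt.comp_hasDerivAt x h1
      have h3 : Complex.imCLM (G (f n) x) = 0 := hG x
      rw [h3] at h2
      exact h2
    intro x
    have := is_const_of_deriv_eq_zero (fun x => (hd x).differentiableAt)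
      (fun x => (hd x).deriv) x 0
    simp only [Complex.ofReal_zero] at this
    rw [this, f_zero]
    simp

/-- The derivatives of the increments on the real line. -/
noncomputable def v (k n : ℕ) (x : ℝ) : ℝ := (iteratedDeriv k (D n) (x : ℂ)).re

/-- The summed derivatives. -/
noncomputable def U (k : ℕ) (x : ℝ) : ℝ := ∑' n, v k n x

/-- Real open interval. -/
def S : Set ℝ := Ioo (-(1005 / 1000)) (1005 / 1000)

lemma v_bound (k n : ℕ) (x : ℝ) (hx : x ∈ S) :
    ‖v k n x‖ ≤ (k.factorial : ℝ) ^ 2 * 800 ^ k * (4 / 3) * (8 / 9) ^ n := by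
  have hr := rad_pos n
  have hC := Complex.norm_iteratedDeriv_le_of_forall_mem_sphere_norm_le (c := (x : ℂ)) (R := rad n / 2)
    (C := (2 / 3) ^ n) k (by positivity) (D_diff n).diffContOnCl (by
      intro z hz
      apply D_bound
      have hz' : ‖z - x‖ = rad n / 2 := by simpa [dist_eq_norm] using hz
      have h1 := Complex.abs_re_le_norm (z - x)
      have h2 := Complex.abs_im_le_norm (z - x)
      simp only [Complex.sub_re, Complex.sub_im, Complex.ofReal_re, Complex.ofReal_im, sub_zero] at h1 h2
      rw [hz'] at h1 h2
      have := rad_le n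
      refine ⟨?_, by linarith⟩
      have hx1 := hx.1
      have hx2 := hx.2
      have h3 := abs_le.1 h1
      rw [abs_lt]
      constructor <;> linarith [h3.1, h3.2])
  have h1 : ‖v k n x‖ ≤ k.factorial * (2 / 3) ^ n / (rad n / 2) ^ k :=
    (Complex.abs_re_le_norm _).trans hC
  refine h1.trans ?_
  have h2 := Real.pow_div_factorial_le_exp (x := ((n : ℝ) + 1) / 4) (by positivity) k
  have h3 : Real.exp (((n : ℝ) + 1) / 4) ≤ (4 / 3) ^ (n + 1) := by
    have : ((n : ℝ) + 1) / 4 = ((n + 1 : ℕ) : ℝ) * (1 / 4) := by push_cast; ring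
    rw [this, Real.exp_nat_mul]
    gcongr
    refine (Real.exp_bound_div_one_sub_of_interval (by norm_num) (by norm_num)).trans (by norm_num)
  have hk : (0 : ℝ) < k.factorial := by exact_mod_cast Nat.factorial_pos k
  have h4 : (((n : ℝ) + 1) / 4) ^ k ≤ (4 / 3) ^ (n + 1) * k.factorial := by
    rw [← div_le_iff₀ hk]; exact h2.trans h3
  have h5 : ((rad n / 2) ^ k)⁻¹ = 800 ^ k * (((n : ℝ) + 1) / 4) ^ k := by
    rw [← inv_pow, ← mul_pow]
    congr 1
    unfold rad
    field_simp
    norm_num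
  rw [div_eq_mul_inv, h5]
  calc (k.factorial : ℝ) * (2 / 3) ^ n * (800 ^ k * (((n : ℝ) + 1) / 4) ^ k)
      ≤ (k.factorial : ℝ) * (2 / 3) ^ n * (800 ^ k * ((4 / 3) ^ (n + 1) * k.factorial)) := by gcongr
    _ = (k.factorial : ℝ) ^ 2 * 800 ^ k * (4 / 3) * ((2 / 3) * (4 / 3)) ^ n := by
        rw [mul_pow]; ring
    _ = _ := by norm_num

lemma bd_summable (c : ℝ) : Summable (fun n : ℕ => c * (8 / 9 : ℝ) ^ n) :=
  (summable_geometric_of_lt_one (by norm_num) (by norm_num)).mul_left c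

lemma v_summable (k : ℕ) (x : ℝ) (hx : x ∈ S) : Summable (fun n => v k n x) :=
  Summable.of_norm_bounded (bd_summable _) (fun n => v_bound k n x hx)

lemma U_bound (k : ℕ) (x : ℝ) (hx : x ∈ S) : |U k x| ≤ (k.factorial : ℝ) ^ 2 * 800 ^ k * 12 := by
  have h := tsum_of_norm_bounded
    ((hasSum_geometric_of_lt_one (r := (8 / 9 : ℝ)) (by norm_num) (by norm_num)).mul_left
      ((k.factorial : ℝ) ^ 2 * 800 ^ k * (4 / 3))) (fun n => v_bound k n x hx)
  refine h.trans (le_of_eq ?_)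
  norm_num
  ring

lemma v_deriv (k n : ℕ) (x : ℝ) : HasDerivAt (v k n) (v (k + 1) n x) x := by
  have h : HasDerivAt (iteratedDeriv k (D n)) (iteratedDeriv (k + 1) (D n) x) (x : ℂ) := by
    rw [iteratedDeriv_succ]
    apply DifferentiableAt.hasDerivAt
    have : ContDiff ℂ (⊤ : ℕ∞) (D n) := (D_diff n).contDiff
    exact (this.differentiable_iteratedDeriv k (by exact_mod_cast WithTop.coe_lt_top _)) _
  exact h.real_of_complex

lemma zero_mem_S : (0 : ℝ) ∈ S := by constructor <;> norm_num

lemma U_deriv (k : ℕ) (x : ℝ) (hx : x ∈ S) : HasDerivAt (U k) (U (k + 1) x) x :=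
  hasDerivAt_tsum_of_isPreconnected (bd_summable _) isOpen_Ioo isPreconnected_Ioo
    (fun n y _ => v_deriv k n y) (fun n y hy => v_bound (k + 1) n y hy) zero_mem_S
    (v_summable k 0 zero_mem_S) hx

lemma Icc_sub : Icc (-1 : ℝ) 1 ⊆ S := fun x hx =>
  ⟨by linarith [hx.1], by linarith [hx.2]⟩

lemma iter_U (k : ℕ) : ∀ x ∈ Icc (-1 : ℝ) 1,
    iteratedDerivWithin k (U 0) (Icc (-1 : ℝ) 1) x = U k x := by
  induction k with
  | zero => intro x _; simp
  | succ k ih =>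
    intro x hx
    rw [iteratedDerivWithin_succ, derivWithin_congr ih (ih x hx)]
    exact (U_deriv k x (Icc_sub hx)).hasDerivWithinAt.derivWithin
      ((uniqueDiffOn_Icc (by norm_num)) x hx)

lemma U_gevrey : GevreyOn 1 (U 0) := by
  constructor
  · apply contDiffOn_of_differentiableOn_deriv
    intro m _
    apply DifferentiableOn.congr _ (iter_U m)
    intro x hx
    exact (U_deriv m x (Icc_sub hx)).differentiableAt.differentiableWithinAt
  · refine ⟨800, by norm_num, fun n x hx => ?_⟩
    rw [iter_U n x hx]
    refine (U_bound n x (Icc_sub hx)).trans ?_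
    have h1 : (n : ℝ) ^ ((n : ℝ) * (1 + 1 / 1)) = ((n : ℝ) ^ n) ^ 2 := by
      have : (n : ℝ) * (1 + 1 / 1) = ((n * 2 : ℕ) : ℝ) := by push_cast; ring
      rw [this, Real.rpow_natCast, pow_mul]
    rw [h1]
    have h2 : (n.factorial : ℝ) ≤ (n : ℝ) ^ n := by exact_mod_cast Nat.factorial_le_pow n
    calc (n.factorial : ℝ) ^ 2 * 800 ^ n * 12 ≤ ((n : ℝ) ^ n) ^ 2 * 800 ^ n * 800 := by
          gcongr; norm_num
      _ = _ := by ring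

lemma f_tendsto (x : ℝ) (hx : x ∈ S) :
    Filter.Tendsto (fun n => (f n x).re) Filter.atTop (nhds (U 0 x)) := by
  have h := (v_summable 0 x hx).hasSum.tendsto_sum_nat
  have h2 := h.comp (Filter.tendsto_add_atTop_nat 1)
  refine h2.congr (fun n => ?_)
  simp only [Function.comp, v, iteratedDeriv_zero]
  rw [← Complex.re_sum, D_sum]

lemma f_deriv_tendsto (x : ℝ) (hx : x ∈ S) :
    Filter.Tendsto (fun n => (G (f n) x).re) Filter.atTop (nhds (U 1 x)) := by
  have h := (v_summable 1 x hx).hasSum.tendsto_sum_nat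
  have h2 := h.comp (Filter.tendsto_add_atTop_nat 2)
  refine h2.congr (fun n => ?_)
  simp only [Function.comp, v, iteratedDeriv_one]
  rw [← Complex.re_sum]
  congr 1
  have h3 : HasDerivAt (fun z => ∑ i ∈ Finset.range (n + 2), D i z)
      (∑ i ∈ Finset.range (n + 2), deriv (D i) x) (x : ℂ) :=
    HasDerivAt.fun_sum (fun i _ => (D_diff i _).hasDerivAt)
  have h4 : (fun z => ∑ i ∈ Finset.range (n + 2), D i z) = f (n + 1) := by
    ext z; exact D_sum (n + 1) z
  rw [h4] at h3
  exact h3.unique (f_deriv n x)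

lemma G_re (n : ℕ) (x : ℝ) : (G (f n) x).re = Real.exp (Real.log 2 * x) * Real.log 2 *
          (2 * ((f n (Real.sin x : ℝ)).re ^ 4 - (f n (Real.sin x : ℝ)).re ^ 2
            + (1 / 8) * (f n (Real.sin x : ℝ)).re) + 1 / 150) := by
  have hs : f n (Real.sin x : ℝ) = ((f n (Real.sin x : ℝ)).re : ℝ) := by
    apply Complex.ext
    · simp
    · rw [f_real]; simp
  have : G (f n) x = ((Real.exp (Real.log 2 * x) * Real.log 2 *
          (2 * ((f n (Real.sin x : ℝ)).re ^ 4 - (f n (Real.sin x : ℝ)).re ^ 2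
            + (1 / 8) * (f n (Real.sin x : ℝ)).re) + 1 / 150) : ℝ) : ℂ) := by
    unfold G E Q
    rw [← Complex.ofReal_sin, hs]
    push_cast
    simp
  rw [this, Complex.ofReal_re]

lemma sin_mem_S (x : ℝ) : Real.sin x ∈ S :=
  Icc_sub ⟨Real.neg_one_le_sin x, Real.sin_le_one x⟩

lemma U_one (x : ℝ) (hx : x ∈ S) : U 1 x = Real.exp (Real.log 2 * x) * Real.log 2 *
          (2 * ((U 0 (Real.sin x)) ^ 4 - (U 0 (Real.sin x)) ^ 2
            + (1 / 8) * (U 0 (Real.sin x))) + 1 / 150) := by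
  have h1 := f_deriv_tendsto x hx
  have h2 := f_tendsto _ (sin_mem_S x)
  simp_rw [G_re] at h1
  refine tendsto_nhds_unique h1 ?_
  exact (((((h2.pow 4).sub (h2.pow 2)).add (h2.const_mul _)).const_mul 2).add_const _).const_mul _

lemma U_zero : U 0 0 = 1 / 100 := by
  have h := f_tendsto 0 zero_mem_S
  simp only [Complex.ofReal_zero, f_zero] at h
  have := tendsto_nhds_unique h tendsto_const_nhds
  rw [this]
  norm_num

end GevreyEx

/-- Example 2: the FDE
`y′(t) = 2 ln 2 · 2^t ((y(sin t))⁴ − (y(sin t))² + (1/8) y(sin t) − 1) + (301 ln 2/150) 2^t`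
on `[-1,1]` with `y(0) = 1/100` has a solution in the Gevrey class `G₁([-1,1])`. -/
theorem stmt14 :
    ∃ u : ℝ → ℝ, GevreyOn 1 u ∧ u 0 = 1/100 ∧
      ∀ t ∈ Icc (-1:ℝ) 1,
        HasDerivWithinAt u
          (2 * Real.log 2 * (2:ℝ) ^ t *
              ((u (Real.sin t)) ^ 4 - (u (Real.sin t)) ^ 2 + (1/8) * u (Real.sin t) - 1)
            + (301 * Real.log 2 / 150) * (2:ℝ) ^ t)
          (Icc (-1:ℝ) 1) t := by
  refine ⟨GevreyEx.U 0, GevreyEx.U_gevrey, GevreyEx.U_zero, fun t ht => ?_⟩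
  have h := (GevreyEx.U_deriv 0 t (GevreyEx.Icc_sub ht)).hasDerivWithinAt (s := Icc (-1 : ℝ) 1)
  rw [zero_add, GevreyEx.U_one t (GevreyEx.Icc_sub ht)] at h
  refine h.congr_deriv ?_
  rw [Real.rpow_def_of_pos (by norm_num)]
  ring
end
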